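/- arXiv:2102.10093 — 3 statements merged into one kernel-verified Lean document; each statement's English description precedes it below -/
import Mathlib

section
/- Let A, B be nonnegative d×d real matrices with AB ≠ 0, and let ‖·‖ be a seminorm on ℝ^d which restricts to a norm on f^⊥ for every nonzero f ∈ (A ℝ^d_{≥0} ∪ B ℝ^d_{≥0}). Then ‖(AB)ᵀ‖^{AB ℝ^d_{≥0}} ≤ ‖Bᵀ‖^{B ℝ^d_{≥0}} · ‖Aᵀ‖^{A ℝ^d_{≥0}}. -/
open Matrix Filter MeasureTheory

noncomputable section

/-- The product `M 0 * M 1 * ... * M (n-1)`. -/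
def pprod {d : ℕ} (M : ℕ → Matrix (Fin d) (Fin d) ℝ) (n : ℕ) : Matrix (Fin d) (Fin d) ℝ :=
  ((List.range n).map M).prod

/-- The product `M r * M (r+1) * ... * M (s-1)`. -/
def segProd {d : ℕ} (M : ℕ → Matrix (Fin d) (Fin d) ℝ) (r s : ℕ) : Matrix (Fin d) (Fin d) ℝ :=
  ((List.range (s - r)).map (fun k => M (r + k))).prod

/-- A sequence of nonnegative matrices is primitive if every tail has a finite
initial product with all entries positive. -/
def IsPrimitiveSeq {d : ℕ} (M : ℕ → Matrix (Fin d) (Fin d) ℝ) : Prop :=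
  ∀ r : ℕ, ∃ s : ℕ, r < s ∧ ∀ i j, 0 < segProd M r s i j

/-- The image of the nonnegative orthant under `M`. -/
def cone {d : ℕ} (M : Matrix (Fin d) (Fin d) ℝ) : Set (Fin d → ℝ) :=
  {y | ∃ x : Fin d → ℝ, (∀ i, 0 ≤ x i) ∧ y = M.mulVec x}

/-- The ray generated by `u`. -/
def ray {d : ℕ} (u : Fin d → ℝ) : Set (Fin d → ℝ) := {y | ∃ t : ℝ, 0 ≤ t ∧ y = t • u}

/-- The matrix seminorm associated with a seminorm `N` and a cone `Λ`:
the sup over nonzero `f ∈ Λ` and nonzero `z ⊥ f` of `N (M z) / N z`. -/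
def matSemiNorm {d : ℕ} (N : (Fin d → ℝ) → ℝ) (M : Matrix (Fin d) (Fin d) ℝ)
    (Λ : Set (Fin d → ℝ)) : ℝ :=
  sSup {r : ℝ | ∃ f ∈ Λ, f ≠ 0 ∧
    ∃ z : Fin d → ℝ, z ≠ 0 ∧ (∑ i, z i * f i) = 0 ∧ r = N (M.mulVec z) / N z}

theorem Seminorm.continuous_of_finiteDimensional {E : Type*} [NormedAddCommGroup E]
    [NormedSpace ℝ E] [FiniteDimensional ℝ E] (p : Seminorm ℝ E) : Continuous p :=
  continuousOn_univ.1 (p.convexOn.continuousOn isOpen_univ)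

/-- Nonzero vectors of the cone of a nonnegative matrix are, up to positive scaling, images of
points of the standard simplex supported on the nonzero columns. -/
theorem exists_stdSimplex_of_mem_cone {d : ℕ} {A : Matrix (Fin d) (Fin d) ℝ}
    {f : Fin d → ℝ} (hf : f ∈ cone A) (hf0 : f ≠ 0) :
    ∃ x ∈ stdSimplex ℝ (Fin d), (∀ j, (∀ i, A i j = 0) → x j = 0) ∧
      ∃ c : ℝ, A.mulVec x = c • f := by
  classical
  obtain ⟨x, hx, rfl⟩ := hf
  set y : Fin d → ℝ := fun j => if ∀ i, A i j = 0 then 0 else x j with hy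
  have hy0 : ∀ j, 0 ≤ y j := fun j => by
    simp only [hy]; split_ifs
    · exact le_rfl
    · exact hx j
  have hAy : A.mulVec y = A.mulVec x := by
    ext i
    change ∑ j, A i j * y j = ∑ j, A i j * x j
    refine Finset.sum_congr rfl fun j _ => ?_
    by_cases h : ∀ i, A i j = 0
    · simp [h i]
    · simp only [hy, if_neg h]
  have hs : 0 < ∑ j, y j := by
    refine lt_of_le_of_ne (Finset.sum_nonneg fun j _ => hy0 j) fun h => hf0 ?_
    have hz : y = 0 := by
      ext j
      exact (Finset.sum_eq_zero_iff_of_nonneg fun j _ => hy0 j).1 h.symm j (Finset.mem_univ j)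
    rw [← hAy, hz, mulVec_zero]
  refine ⟨(∑ j, y j)⁻¹ • y, ⟨fun j => mul_nonneg (inv_nonneg.2 hs.le) (hy0 j), ?_⟩,
    fun j hj => by simp [hy, hj], (∑ j, y j)⁻¹, by rw [mulVec_smul, hAy]⟩
  simp only [Pi.smul_apply, smul_eq_mul, ← Finset.mul_sum]
  exact inv_mul_cancel₀ hs.ne'

theorem mulVec_ne_zero_of_mem_stdSimplex {d : ℕ} {A : Matrix (Fin d) (Fin d) ℝ}
    (hA : ∀ i j, 0 ≤ A i j) {x : Fin d → ℝ} (hx : x ∈ stdSimplex ℝ (Fin d))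
    (hsupp : ∀ j, (∀ i, A i j = 0) → x j = 0) : A.mulVec x ≠ 0 := by
  intro h
  have hx0 : ∀ j, x j = 0 := fun j => by
    by_contra hj
    refine hj (hsupp j fun i => ?_)
    have hi : ∑ k, A i k * x k = 0 := congrFun h i
    have := (Finset.sum_eq_zero_iff_of_nonneg
      fun k _ => mul_nonneg (hA i k) (hx.1 k)).1 hi j (Finset.mem_univ j)
    exact (mul_eq_zero.1 this).resolve_right hj
  simpa [hx0] using hx.2

theorem bddAbove_ratio {d : ℕ} {A : Matrix (Fin d) (Fin d) ℝ} (hA : ∀ i j, 0 ≤ A i j)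
    (M : Matrix (Fin d) (Fin d) ℝ) (p : Seminorm ℝ (Fin d → ℝ))
    (hp : ∀ f ∈ cone A, f ≠ 0 → ∀ z : Fin d → ℝ, (∑ i, z i * f i) = 0 → p z = 0 → z = 0) :
    BddAbove {r : ℝ | ∃ f ∈ cone A, f ≠ 0 ∧
      ∃ z : Fin d → ℝ, z ≠ 0 ∧ (∑ i, z i * f i) = 0 ∧ r = p (M.mulVec z) / p z} := by
  have hpc := p.continuous_of_finiteDimensional
  let T : Set ((Fin d → ℝ) × (Fin d → ℝ)) :=
    {q | (∀ j, (∀ i, A i j = 0) → q.1 j = 0) ∧ ∑ i, q.2 i * A.mulVec q.1 i = 0}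
  have hT : IsClosed T := by
    have hT_eq : T = (⋂ j, ⋂ _ : ∀ i, A i j = 0, {q | q.1 j = 0}) ∩
        {q | ∑ i, q.2 i * A.mulVec q.1 i = 0} := by
      ext q
      simp [T]
    rw [hT_eq]
    refine IsClosed.inter ?_ ?_
    · exact isClosed_iInter fun j => isClosed_iInter fun _ =>
        isClosed_eq (by fun_prop) continuous_const
    · refine isClosed_eq (continuous_finsetSum _ fun i _ => ?_) continuous_const
      have : Continuous fun q : (Fin d → ℝ) × (Fin d → ℝ) => A.mulVec q.1 :=
        continuous_const.matrix_mulVec continuous_fst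
      fun_prop
  have hK : IsCompact ((stdSimplex ℝ (Fin d) ×ˢ Metric.sphere (0 : Fin d → ℝ) 1) ∩ T) :=
    ((isCompact_stdSimplex ℝ (Fin d)).prod (isCompact_sphere 0 1)).inter_right hT
  have hcont : ContinuousOn (fun q : (Fin d → ℝ) × (Fin d → ℝ) => p (M.mulVec q.2) / p q.2)
      ((stdSimplex ℝ (Fin d) ×ˢ Metric.sphere (0 : Fin d → ℝ) 1) ∩ T) := by
    refine ContinuousOn.div
      (hpc.comp (continuous_const.matrix_mulVec continuous_snd)).continuousOn
      (hpc.comp continuous_snd).continuousOn ?_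
    rintro ⟨x, z⟩ ⟨⟨hx, hz⟩, hsupp, hxz⟩ h0
    have := hp _ ⟨x, hx.1, rfl⟩ (mulVec_ne_zero_of_mem_stdSimplex hA hx hsupp) z hxz h0
    simp [this] at hz
  refine (hK.bddAbove_image hcont).mono ?_
  rintro r ⟨f, hf, hf0, z, hz, hzf, rfl⟩
  obtain ⟨x, hx, hsupp, c, hc⟩ := exists_stdSimplex_of_mem_cone hf hf0
  have hn : ‖z‖ ≠ 0 := norm_ne_zero_iff.2 hz
  refine ⟨(x, ‖z‖⁻¹ • z), ⟨⟨hx, ?_⟩, hsupp, ?_⟩, ?_⟩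
  · simp [norm_smul, hn]
  · have : ∀ i, (‖z‖⁻¹ • z) i * (c • f) i = ‖z‖⁻¹ * c * (z i * f i) := fun i => by
      simp only [Pi.smul_apply, smul_eq_mul]; ring
    simp only [hc, this, ← Finset.mul_sum, hzf, mul_zero]
  · simp only [mulVec_smul, map_smul_eq_mul]
    exact mul_div_mul_left _ _ (by simpa using hz)

theorem matSemiNorm_submultiplicative {d : ℕ}
    (A B : Matrix (Fin d) (Fin d) ℝ)
    (hA : ∀ i j, 0 ≤ A i j) (hB : ∀ i j, 0 ≤ B i j) (hAB : A * B ≠ 0)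
    (N : (Fin d → ℝ) → ℝ)
    (hadd : ∀ x y, N (x + y) ≤ N x + N y)
    (hsmul : ∀ (a : ℝ) (x : Fin d → ℝ), N (a • x) = |a| * N x)
    (hperp : ∀ f, f ∈ cone A ∪ cone B → f ≠ 0 →
      ∀ z : Fin d → ℝ, (∑ i, z i * f i) = 0 → N z = 0 → z = 0) :
    matSemiNorm N (A * B)ᵀ (cone (A * B)) ≤
      matSemiNorm N Bᵀ (cone B) * matSemiNorm N Aᵀ (cone A) := by
  let p : Seminorm ℝ (Fin d → ℝ) := Seminorm.of N hadd hsmul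
  have hN : ∀ x, 0 ≤ N x := apply_nonneg p
  have hbA := bddAbove_ratio hA Aᵀ p fun f hf => hperp f (Or.inl hf)
  have hbB := bddAbove_ratio hB Bᵀ p fun f hf => hperp f (Or.inr hf)
  have hnonneg : ∀ M Λ, 0 ≤ matSemiNorm N M Λ := fun M Λ => by
    refine Real.sSup_nonneg ?_
    rintro r ⟨f, -, -, z, -, -, rfl⟩
    exact div_nonneg (hN _) (hN _)
  refine Real.sSup_le ?_ (mul_nonneg (hnonneg _ _) (hnonneg _ _))
  rintro r ⟨f, ⟨x, hx, rfl⟩, hf0, z, hz, hzf, rfl⟩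
  rw [← mulVec_mulVec] at hf0 hzf
  have hBx : ∀ i, 0 ≤ B.mulVec x i := fun i => show 0 ≤ ∑ j, B i j * x j from
    Finset.sum_nonneg fun j _ => mul_nonneg (hB i j) (hx j)
  have hBx0 : B.mulVec x ≠ 0 := fun h => hf0 (by rw [h, mulVec_zero])
  rw [transpose_mul, ← mulVec_mulVec]
  by_cases hw : Aᵀ.mulVec z = 0
  · have hN0 : N 0 = 0 := map_zero p
    rw [hw, mulVec_zero, hN0, zero_div]
    exact mul_nonneg (hnonneg _ _) (hnonneg _ _)
  have hwf : ∑ i, Aᵀ.mulVec z i * B.mulVec x i = 0 := by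
    change Aᵀ.mulVec z ⬝ᵥ B.mulVec x = 0
    rw [mulVec_transpose, ← dotProduct_mulVec]
    exact hzf
  have hNw : N (Aᵀ.mulVec z) ≠ 0 := fun h =>
    hw (hperp _ (Or.inr ⟨x, hx, rfl⟩) hBx0 _ hwf h)
  rw [← div_mul_div_cancel₀ hNw]
  exact mul_le_mul
    (le_csSup hbB ⟨_, ⟨x, hx, rfl⟩, hBx0, _, hw, hwf, rfl⟩)
    (le_csSup hbA ⟨_, ⟨_, hBx, rfl⟩, hf0, z, hz, hzf, rfl⟩)
    (div_nonneg (hN _) (hN _)) (hnonneg _ _)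
end
end

section
/- Let A = (a_{ij}) be a d×d real matrix with all entries positive. Then the diameter of the cone A ℝ^d_{≥0} with respect to the semimetric d_M satisfies diam(A ℝ^d_{≥0}) ≤ (1 / min_{1≤i,j≤d} a_{ij}) · ‖Aᵀ‖₂^{A ℝ^d_{≥0}}. -/
open Matrix Filter MeasureTheory

noncomputable section

/-- The Euclidean norm on `Fin d → ℝ`. -/
def norm2 {d : ℕ} (v : Fin d → ℝ) : ℝ := Real.sqrt (∑ i, (v i) ^ 2)

/-- The semimetric `d_M` on rays of the nonnegative orthant. -/
def dM {d : ℕ} (v w : Fin d → ℝ) : ℝ :=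
  (1 / (norm2 v * norm2 w)) * sSup {r : ℝ | ∃ i j, r = |v i * w j - v j * w i|}

/-- The diameter of a cone with respect to the semimetric `d_M`. -/
def coneDiam {d : ℕ} (Λ : Set (Fin d → ℝ)) : ℝ :=
  sSup {r : ℝ | ∃ v ∈ Λ, v ≠ 0 ∧ ∃ w ∈ Λ, w ≠ 0 ∧ r = dM v w}

/-- The matrix seminorm associated with the Euclidean norm and a cone `Λ`:
the sup over nonzero `f ∈ Λ` and nonzero `z ⊥ f` of `norm2 (M z) / norm2 z`. -/
def matSemiNorm2 {d : ℕ} (M : Matrix (Fin d) (Fin d) ℝ) (Λ : Set (Fin d → ℝ)) : ℝ :=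
  sSup {r : ℝ | ∃ f ∈ Λ, f ≠ 0 ∧
    ∃ z : Fin d → ℝ, z ≠ 0 ∧ (∑ i, z i * f i) = 0 ∧ r = norm2 (M.mulVec z) / norm2 z}

/-- The minimal entry of a matrix. -/
def minEntry {d : ℕ} (A : Matrix (Fin d) (Fin d) ℝ) : ℝ :=
  sInf {r : ℝ | ∃ i j, r = A i j}

lemma norm2_nonneg {d : ℕ} (v : Fin d → ℝ) : 0 ≤ norm2 v := Real.sqrt_nonneg _

lemma norm2_sq {d : ℕ} (v : Fin d → ℝ) : norm2 v ^ 2 = ∑ i, (v i) ^ 2 :=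
  Real.sq_sqrt (Finset.sum_nonneg fun _ _ => sq_nonneg _)

lemma norm2_pos {d : ℕ} {v : Fin d → ℝ} (hv : v ≠ 0) : 0 < norm2 v := by
  obtain ⟨i, hi⟩ := Function.ne_iff.mp hv
  exact Real.sqrt_pos.mpr <| Finset.sum_pos' (fun _ _ => sq_nonneg _)
    ⟨i, Finset.mem_univ i, sq_pos_of_ne_zero hi⟩

lemma le_norm2 {d : ℕ} (v : Fin d → ℝ) (i : Fin d) : v i ≤ norm2 v :=
  Real.le_sqrt_of_sq_le <|
    Finset.single_le_sum (f := fun j => (v j) ^ 2) (fun _ _ => sq_nonneg _) (Finset.mem_univ i)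

lemma norm2_le_sum {d : ℕ} {v : Fin d → ℝ} (hv : ∀ i, 0 ≤ v i) : norm2 v ≤ ∑ i, v i :=
  Real.sqrt_le_iff.mpr ⟨Finset.sum_nonneg fun i _ => hv i,
    Finset.sum_sq_le_sq_sum_of_nonneg fun i _ => hv i⟩

/-- The Cauchy-Schwarz inequality for the dot product. -/
lemma abs_dotProduct_le_norm2_mul {d : ℕ} (v w : Fin d → ℝ) :
    |v ⬝ᵥ w| ≤ norm2 v * norm2 w := by
  refine abs_le_of_sq_le_sq ?_ (mul_nonneg (norm2_nonneg v) (norm2_nonneg w))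
  rw [mul_pow, norm2_sq, norm2_sq]
  exact Finset.sum_mul_sq_le_sq_mul_sq _ _ _

/-- The Euclidean operator norm is bounded by the Frobenius norm. -/
lemma norm2_mulVec_le {d : ℕ} (M : Matrix (Fin d) (Fin d) ℝ) (z : Fin d → ℝ) :
    norm2 (M *ᵥ z) ≤ Real.sqrt (∑ i, ∑ j, (M i j) ^ 2) * norm2 z := by
  have hF : 0 ≤ ∑ i, ∑ j, (M i j) ^ 2 :=
    Finset.sum_nonneg fun _ _ => Finset.sum_nonneg fun _ _ => sq_nonneg _
  rw [norm2, norm2, ← Real.sqrt_mul hF, Finset.sum_mul]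
  exact Real.sqrt_le_sqrt <| Finset.sum_le_sum fun i _ =>
    Finset.sum_mul_sq_le_sq_mul_sq Finset.univ (M i) z

lemma matSemiNorm2_nonneg {d : ℕ} (M : Matrix (Fin d) (Fin d) ℝ) (Λ : Set (Fin d → ℝ)) :
    0 ≤ matSemiNorm2 M Λ := by
  refine Real.sSup_nonneg ?_
  rintro r ⟨f, -, -, z, -, -, rfl⟩
  exact div_nonneg (norm2_nonneg _) (norm2_nonneg _)

/-- The seminorm controls the action of the matrix on vectors orthogonal to the cone. -/
lemma norm2_mulVec_le_matSemiNorm2 {d : ℕ} (M : Matrix (Fin d) (Fin d) ℝ)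
    {Λ : Set (Fin d → ℝ)} {f : Fin d → ℝ} (hf : f ∈ Λ) (hf0 : f ≠ 0) {z : Fin d → ℝ}
    (hz : ∑ i, z i * f i = 0) :
    norm2 (M *ᵥ z) ≤ matSemiNorm2 M Λ * norm2 z := by
  rcases eq_or_ne z 0 with rfl | hz0
  · simp [norm2]
  · rw [← div_le_iff₀ (norm2_pos hz0)]
    refine le_csSup ⟨Real.sqrt (∑ i, ∑ j, (M i j) ^ 2), ?_⟩ ⟨f, hf, hf0, z, hz0, hz, rfl⟩
    rintro r ⟨g, -, -, y, hy, -, rfl⟩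
    exact (div_le_iff₀ (norm2_pos hy)).mpr (norm2_mulVec_le M y)

lemma finite_setOf_eq_entry {d : ℕ} (A : Matrix (Fin d) (Fin d) ℝ) :
    {r : ℝ | ∃ i j, r = A i j}.Finite := by
  refine (Set.finite_range fun p : Fin d × Fin d => A p.1 p.2).subset ?_
  rintro r ⟨i, j, rfl⟩
  exact ⟨(i, j), rfl⟩

lemma minEntry_le {d : ℕ} (A : Matrix (Fin d) (Fin d) ℝ) (i j : Fin d) :
    minEntry A ≤ A i j :=
  csInf_le (finite_setOf_eq_entry A).bddBelow ⟨i, j, rfl⟩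

lemma minEntry_nonneg {d : ℕ} {A : Matrix (Fin d) (Fin d) ℝ} (hA : ∀ i j, 0 < A i j) :
    0 ≤ minEntry A := by
  refine Real.sInf_nonneg ?_
  rintro r ⟨i, j, rfl⟩
  exact (hA i j).le

lemma minEntry_pos {d : ℕ} [NeZero d] {A : Matrix (Fin d) (Fin d) ℝ} (hA : ∀ i j, 0 < A i j) :
    0 < minEntry A := by
  obtain ⟨i, j, h⟩ := Set.Nonempty.csInf_mem (s := {r : ℝ | ∃ i j, r = A i j}) ⟨_, 0, 0, rfl⟩
    (finite_setOf_eq_entry A)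
  exact (hA i j).trans_eq h.symm

/-- A positive matrix expands nonnegative vectors by at least its minimal entry. -/
lemma minEntry_mul_norm2_le {d : ℕ} [NeZero d] {A : Matrix (Fin d) (Fin d) ℝ}
    (hA : ∀ i j, 0 < A i j) {x : Fin d → ℝ} (hx : ∀ i, 0 ≤ x i) :
    minEntry A * norm2 x ≤ norm2 (A *ᵥ x) :=
  calc minEntry A * norm2 x ≤ minEntry A * ∑ j, x j :=
        mul_le_mul_of_nonneg_left (norm2_le_sum hx) (minEntry_pos hA).le
    _ = ∑ j, minEntry A * x j := Finset.mul_sum _ _ _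
    _ ≤ (A *ᵥ x) 0 :=
        Finset.sum_le_sum fun j _ => mul_le_mul_of_nonneg_right (minEntry_le A 0 j) (hx j)
    _ ≤ norm2 (A *ᵥ x) := le_norm2 _ 0

/-- Rotating a coordinate pair by a right angle and dropping the other coordinates does not
increase the Euclidean norm. -/
lemma norm2_single_sub_single_le {d : ℕ} (w : Fin d → ℝ) {i j : Fin d} (hij : i ≠ j) :
    norm2 (Pi.single i (w j) - Pi.single j (w i)) ≤ norm2 w := by
  refine Real.sqrt_le_sqrt ?_
  calc ∑ k, ((Pi.single i (w j) - Pi.single j (w i) : Fin d → ℝ) k) ^ 2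
      = ∑ k, ((if k = i then (w j) ^ 2 else 0) + (if k = j then (w i) ^ 2 else 0)) := by
        refine Finset.sum_congr rfl fun k _ => ?_
        simp only [Pi.sub_apply, Pi.single_apply]
        split_ifs with h₁ h₂ <;> simp_all
    _ = ∑ k ∈ {i, j}, (w k) ^ 2 := by
        rw [Finset.sum_add_distrib, Finset.sum_pair hij]
        simp [add_comm]
    _ ≤ ∑ k, (w k) ^ 2 :=
        Finset.sum_le_sum_of_subset_of_nonneg (Finset.subset_univ _) fun _ _ _ => sq_nonneg _

lemma abs_minor_le {d : ℕ} (A : Matrix (Fin d) (Fin d) ℝ) (x : Fin d → ℝ) {w : Fin d → ℝ}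
    (hw : w ∈ cone A) (hw0 : w ≠ 0) (i j : Fin d) :
    |(A *ᵥ x) i * w j - (A *ᵥ x) j * w i| ≤
      norm2 x * (matSemiNorm2 Aᵀ (cone A) * norm2 w) := by
  have hN := matSemiNorm2_nonneg Aᵀ (cone A)
  rcases eq_or_ne i j with rfl | hij
  · simpa using mul_nonneg (norm2_nonneg x) (mul_nonneg hN (norm2_nonneg w))
  set z : Fin d → ℝ := Pi.single i (w j) - Pi.single j (w i) with hz
  have horth : ∑ k, z k * w k = 0 := by
    change z ⬝ᵥ w = 0
    rw [hz, sub_dotProduct, single_dotProduct, single_dotProduct]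
    ring
  have hdot : (A *ᵥ x) i * w j - (A *ᵥ x) j * w i = x ⬝ᵥ (Aᵀ *ᵥ z) := by
    rw [mulVec_transpose, dotProduct_comm x, ← dotProduct_mulVec, hz, sub_dotProduct,
      single_dotProduct, single_dotProduct]
    ring
  rw [hdot]
  refine (abs_dotProduct_le_norm2_mul _ _).trans (mul_le_mul_of_nonneg_left ?_ (norm2_nonneg x))
  exact (norm2_mulVec_le_matSemiNorm2 Aᵀ hw hw0 horth).trans
    (mul_le_mul_of_nonneg_left (norm2_single_sub_single_le w hij) hN)

theorem diam_cone_le {d : ℕ} (A : Matrix (Fin d) (Fin d) ℝ)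
    (hA : ∀ i j, 0 < A i j) :
    coneDiam (cone A) ≤ (1 / minEntry A) * matSemiNorm2 Aᵀ (cone A) := by
  have hN := matSemiNorm2_nonneg Aᵀ (cone A)
  refine Real.sSup_le ?_ (mul_nonneg (one_div_nonneg.mpr (minEntry_nonneg hA)) hN)
  rintro r ⟨v, ⟨x, hx, rfl⟩, hv0, w, hw, hw0, rfl⟩
  obtain ⟨i, -⟩ := Function.ne_iff.mp hv0
  have : NeZero d := ⟨(Fin.pos i).ne'⟩
  have hv := norm2_pos hv0
  have hw' := norm2_pos hw0
  have hm := minEntry_pos hA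
  have hS : sSup {r : ℝ | ∃ i j, r = |(A *ᵥ x) i * w j - (A *ᵥ x) j * w i|} ≤
      norm2 x * (matSemiNorm2 Aᵀ (cone A) * norm2 w) := by
    refine Real.sSup_le ?_ (mul_nonneg (norm2_nonneg x) (mul_nonneg hN hw'.le))
    rintro r ⟨i, j, rfl⟩
    exact abs_minor_le A x hw hw0 i j
  rw [dM, one_div_mul_eq_div, one_div_mul_eq_div, div_le_div_iff₀ (mul_pos hv hw') hm]
  calc _ ≤ norm2 x * (matSemiNorm2 Aᵀ (cone A) * norm2 w) * minEntry A :=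
        mul_le_mul_of_nonneg_right hS hm.le
    _ = minEntry A * norm2 x * (matSemiNorm2 Aᵀ (cone A) * norm2 w) := by ring
    _ ≤ norm2 (A *ᵥ x) * (matSemiNorm2 Aᵀ (cone A) * norm2 w) :=
        mul_le_mul_of_nonneg_right (minEntry_mul_norm2_le hA hx) (mul_nonneg hN hw'.le)
    _ = _ := by ring
end
end

section
/- Let Z be the 3×3 matrix [[1,1,1],[1,1,0],[0,1,1]] (given by rows) and let z : ℝ³_{≥0} → ℝ³ be the linear map x ↦ Zx. Then z is a bijection from ℝ³_{≥0} onto Γ = {y ∈ ℝ³_{≥0} : max(y₂,y₃) ≤ y₁ ≤ y₂+y₃}, it conjugates the map F_C to the semi-sorted Selmer map F_S, i.e., z(F_C(x)) = F_S(z(x)) for all x ∈ ℝ³_{≥0}, and dim_ℚ(x) = dim_ℚ(z(x)) for all x ∈ ℝ³. -/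
open Matrix Filter MeasureTheory

noncomputable section

/-- The dimension over `ℚ` of the vector space spanned by the entries of `x`. -/
def dimQ (x : Fin 3 → ℝ) : ℕ := Module.finrank ℚ (Submodule.span ℚ (Set.range x))

/-- The matrix `Z`. -/
def Zmat : Matrix (Fin 3) (Fin 3) ℝ := !![1,1,1; 1,1,0; 0,1,1]

/-- The continued fraction map `F_C` on the nonnegative orthant. -/
def FC (x : Fin 3 → ℝ) : Fin 3 → ℝ :=
  if x 2 ≤ x 0 then ![x 0 - x 2, x 2, x 1] else ![x 1, x 0, x 2 - x 0]

/-- The semi-sorted Selmer map `F_S` on `Γ`. -/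
def FS (y : Fin 3 → ℝ) : Fin 3 → ℝ :=
  if y 2 ≤ y 1 then ![y 1, y 0 - y 2, y 2] else ![y 2, y 1, y 0 - y 1]

/-- The nonnegative orthant of `ℝ³`. -/
def orthant : Set (Fin 3 → ℝ) := {x | ∀ i, 0 ≤ x i}

/-- The set `Γ` of nonnegative vectors with `max (y 1) (y 2) ≤ y 0 ≤ y 1 + y 2`. -/
def Gam : Set (Fin 3 → ℝ) :=
  {y | (∀ i, 0 ≤ y i) ∧ max (y 1) (y 2) ≤ y 0 ∧ y 0 ≤ y 1 + y 2}

theorem Zmat_mulVec (x : Fin 3 → ℝ) :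
    Zmat.mulVec x = ![x 0 + x 1 + x 2, x 0 + x 1, x 1 + x 2] := by
  ext i
  fin_cases i <;> simp [Zmat, Matrix.mulVec, dotProduct, Fin.sum_univ_three]

theorem bijOn_Zmat_mulVec : Set.BijOn (fun x => Zmat.mulVec x) orthant Gam := by
  refine ⟨fun x hx => ?_, fun x _ y _ hxy => ?_, fun y hy => ?_⟩
  · have h0 := hx 0
    have h1 := hx 1
    have h2 := hx 2
    simp only [Gam, Set.mem_ofPred_eq, Zmat_mulVec, Fin.forall_fin_succ, max_le_iff]
    simp
    refine ⟨⟨?_, ?_, ?_⟩, ⟨?_, ?_⟩, ?_⟩ <;> linarith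
  · simp only [Zmat_mulVec] at hxy
    have h0 := congrFun hxy 0
    have h1 := congrFun hxy 1
    have h2 := congrFun hxy 2
    simp at h0 h1 h2
    ext i
    fin_cases i <;> simp <;> linarith
  · obtain ⟨-, hmax, hle⟩ := hy
    obtain ⟨h1, h2⟩ := max_le_iff.1 hmax
    refine ⟨![y 0 - y 2, y 1 + y 2 - y 0, y 0 - y 1], fun i => ?_, ?_⟩
    · fin_cases i <;> simp <;> linarith
    · ext i
      fin_cases i <;> simp [Zmat_mulVec]

theorem Zmat_mulVec_FC (x : Fin 3 → ℝ) : Zmat.mulVec (FC x) = FS (Zmat.mulVec x) := by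
  have hiff : x 1 + x 2 ≤ x 0 + x 1 ↔ x 2 ≤ x 0 := by
    constructor <;> intro h <;> linarith
  by_cases h : x 2 ≤ x 0 <;> ext i <;> fin_cases i <;>
    simp [Zmat_mulVec, FC, FS, hiff, h] <;> ring

theorem span_range_Zmat_mulVec (x : Fin 3 → ℝ) :
    Submodule.span ℚ (Set.range (Zmat.mulVec x)) = Submodule.span ℚ (Set.range x) := by
  apply le_antisymm <;> rw [Submodule.span_le, Set.range_subset_iff]
  · have hx (i : Fin 3) : x i ∈ Submodule.span ℚ (Set.range x) :=
      Submodule.subset_span ⟨i, rfl⟩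
    rw [Zmat_mulVec]
    intro i
    fin_cases i
    · exact add_mem (add_mem (hx 0) (hx 1)) (hx 2)
    · exact add_mem (hx 0) (hx 1)
    · exact add_mem (hx 1) (hx 2)
  · have hy (i : Fin 3) :
        Zmat.mulVec x i ∈ Submodule.span ℚ (Set.range (Zmat.mulVec x)) :=
      Submodule.subset_span ⟨i, rfl⟩
    intro i
    fin_cases i
    · convert sub_mem (hy 0) (hy 2) using 1
      simp [Zmat_mulVec]
    · convert sub_mem (add_mem (hy 1) (hy 2)) (hy 0) using 1
      simp [Zmat_mulVec]
    · convert sub_mem (hy 0) (hy 1) using 1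
      simp [Zmat_mulVec]

theorem conjugacy_with_selmer :
    Set.BijOn (fun x => Zmat.mulVec x) orthant Gam ∧
    (∀ x ∈ orthant, Zmat.mulVec (FC x) = FS (Zmat.mulVec x)) ∧
    (∀ x : Fin 3 → ℝ, dimQ x = dimQ (Zmat.mulVec x)) := by
  exact ⟨bijOn_Zmat_mulVec, fun x _ => Zmat_mulVec_FC x,
    fun x => by rw [dimQ, dimQ, span_range_Zmat_mulVec]⟩
end
end
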